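/- Let p > 1, γ, λ, μ ∈ ℝ, T > 0, and let û₀ : ℝ² → ℂ be measurable with ‖û₀‖_p < ∞. If v, w : [0,T] → X_p are both continuous and both satisfy, for all t ∈ [0,T] and almost every (k,m), the integral equation v(t)(k,m) = û₀(k,m) e^{i(m² − k²)t} − i ∫₀ᵗ e^{i(k² − m²)(τ − t)} L(v(τ)·e_{2τ})(k,m) dτ (and likewise for w), then v(t) = w(t) in X_p for every t ∈ [0,T]. -/

import Mathlib

open MeasureTheory Filter
open scoped ENNReal Topology

/-- The weighted norm `‖v‖_p = (∫ (1 + |k| + |m|)^(2p) |v(k,m)|² dk dm)^(1/2)` on `ℝ²`. -/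
noncomputable def wnorm (p : ℝ) (v : ℝ × ℝ → ℂ) : ℝ≥0∞ :=
  (∫⁻ km : ℝ × ℝ, ENNReal.ofReal ((1 + |km.1| + |km.2|) ^ (2 * p)) * (‖v km‖₊ : ℝ≥0∞) ^ 2) ^
    ((1 : ℝ) / 2)

/-- The convolution `(f ⋆ g)(ξ) = ∫ f (ξ - η) g η dη` over `ℝ²`. -/
noncomputable def conv (f g : ℝ × ℝ → ℂ) : ℝ × ℝ → ℂ :=
  fun ξ => ∫ η : ℝ × ℝ, f (ξ - η) * g η

/-- `v†(k,m) = conj (v (-k, -m))`, the Fourier transform of the complex conjugate. -/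
def dag (v : ℝ × ℝ → ℂ) : ℝ × ℝ → ℂ :=
  fun km => starRingEnd ℂ (v (-km))

/-- `σ(k,m) = k² / (k² + m²)` for `(k,m) ≠ 0`, and `σ(0,0) = 0`. -/
noncomputable def sigmaMul : ℝ × ℝ → ℝ :=
  fun km => if km = 0 then 0 else km.1 ^ 2 / (km.1 ^ 2 + km.2 ^ 2)

/-- The Fourier-side Davey–Stewartson-II nonlinearity
`L(v) = γ (v ⋆ v† ⋆ v) + λμ (v ⋆ (σ · (v ⋆ v†)))`. -/
noncomputable def Lop (γ lam μ : ℝ) (v : ℝ × ℝ → ℂ) : ℝ × ℝ → ℂ :=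
  fun km => (γ : ℂ) * conv (conv v (dag v)) v km +
    ((lam * μ : ℝ) : ℂ) * conv v (fun η => (sigmaMul η : ℂ) * conv v (dag v) η) km

/-- `e_{2τ}(k,m) = e^{2i(k² - m²)τ}`. -/
noncomputable def phase2 (τ : ℝ) (km : ℝ × ℝ) : ℂ :=
  Complex.exp (2 * Complex.I * (((km.1 ^ 2 - km.2 ^ 2) * τ : ℝ) : ℂ))

/-- The Duhamel (mild-solution) integral operator
`(Av)(t)(k,m) = û₀(k,m) e^{i(m² - k²)t}
  - i ∫₀ᵗ e^{i(k² - m²)(τ - t)} L(v(τ)·e_{2τ})(k,m) dτ`. -/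
noncomputable def duhamel (γ lam μ : ℝ) (u0 : ℝ × ℝ → ℂ) (v : ℝ → ℝ × ℝ → ℂ) (t : ℝ) :
    ℝ × ℝ → ℂ :=
  fun km => u0 km * Complex.exp (Complex.I * (((km.2 ^ 2 - km.1 ^ 2) * t : ℝ) : ℂ)) -
    Complex.I * ∫ τ in (0:ℝ)..t,
      Complex.exp (Complex.I * (((km.1 ^ 2 - km.2 ^ 2) * (τ - t) : ℝ) : ℂ)) *
        Lop γ lam μ (fun km' => v τ km' * phase2 τ km') km

/-- A curve `v : [0,T] → X_p`: measurable values, continuous with respect to `‖·‖_p`. -/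
def ContCurve (p T : ℝ) (v : ℝ → ℝ × ℝ → ℂ) : Prop :=
  (∀ t ∈ Set.Icc (0 : ℝ) T, Measurable (v t)) ∧
  ∀ t₀ ∈ Set.Icc (0 : ℝ) T,
    Tendsto (fun t => wnorm p (v t - v t₀)) (𝓝[Set.Icc (0 : ℝ) T] t₀) (𝓝 0)

section Convolution

variable {f g f' g' : ℝ × ℝ → ℂ} {p q : ℝ≥0∞}

theorem measurable_conv (hf : Measurable f) (hg : Measurable g) : Measurable (conv f g) := by
  refine (StronglyMeasurable.integral_prod_right (f := fun ξ η => f (ξ - η) * g η) ?_).measurable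
  refine Measurable.stronglyMeasurable ?_
  exact (hf.comp (measurable_fst.sub measurable_snd)).mul (hg.comp measurable_snd)

theorem eLpNorm_comp_sub_left (hf : Measurable f) (ξ : ℝ × ℝ) :
    eLpNorm (fun η => f (ξ - η)) p volume = eLpNorm f p volume :=
  eLpNorm_comp_measurePreserving hf.aestronglyMeasurable
    (Measure.measurePreserving_sub_left volume ξ)

theorem enorm_conv_le [ENNReal.HolderTriple p q 1] (hf : Measurable f) (hg : Measurable g)
    (ξ : ℝ × ℝ) : ‖conv f g ξ‖ₑ ≤ eLpNorm f p volume * eLpNorm g q volume := by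
  calc ‖conv f g ξ‖ₑ ≤ ∫⁻ η, ‖f (ξ - η) * g η‖ₑ := enorm_integral_le_lintegral_enorm _
    _ = eLpNorm ((fun η => f (ξ - η)) • g) 1 volume := eLpNorm_one_eq_lintegral_enorm.symm
    _ ≤ eLpNorm (fun η => f (ξ - η)) p volume * eLpNorm g q volume :=
      eLpNorm_smul_le_mul_eLpNorm hg.aestronglyMeasurable
        (hf.comp (measurable_const.sub measurable_id)).aestronglyMeasurable
    _ = _ := by rw [eLpNorm_comp_sub_left hf]

theorem eLpNorm_top_le_of_forall {C : ℝ≥0∞} (hC : ∀ x, ‖f x‖ₑ ≤ C) : eLpNorm f ∞ volume ≤ C := by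
  rw [eLpNorm_exponent_top]
  exact eLpNormEssSup_le_of_ae_enorm_bound (.of_forall hC)

theorem eLpNorm_one_conv_le (hf : Measurable f) (hg : Measurable g) :
    eLpNorm (conv f g) 1 volume ≤ eLpNorm f 1 volume * eLpNorm g 1 volume := by
  simp only [eLpNorm_one_eq_lintegral_enorm]
  have hm : Measurable (fun z : (ℝ × ℝ) × (ℝ × ℝ) => ‖f (z.1 - z.2)‖ₑ * ‖g z.2‖ₑ) :=
    (hf.comp (measurable_fst.sub measurable_snd)).enorm.mul (hg.comp measurable_snd).enorm
  calc ∫⁻ ξ, ‖conv f g ξ‖ₑ ≤ ∫⁻ ξ, ∫⁻ η, ‖f (ξ - η)‖ₑ * ‖g η‖ₑ := by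
        refine lintegral_mono fun ξ => (enorm_integral_le_lintegral_enorm _).trans_eq ?_
        simp only [enorm_mul]
    _ = ∫⁻ η, ∫⁻ ξ, ‖f (ξ - η)‖ₑ * ‖g η‖ₑ := lintegral_lintegral_swap hm.aemeasurable
    _ = ∫⁻ η, (∫⁻ ξ, ‖f ξ‖ₑ) * ‖g η‖ₑ := by
        refine lintegral_congr fun η => ?_
        rw [lintegral_mul_const (f := fun ξ => ‖f (ξ - η)‖ₑ) _
            (hf.comp (measurable_id.sub_const η)).enorm,
          lintegral_sub_right_eq_self (fun ξ => ‖f ξ‖ₑ) η]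
    _ = _ := lintegral_const_mul _ hg.enorm

theorem integrable_conv_integrand [ENNReal.HolderTriple p q 1] (hfm : Measurable f)
    (hf : MemLp f p volume) (hg : MemLp g q volume) (ξ : ℝ × ℝ) :
    Integrable (fun η => f (ξ - η) * g η) := by
  have hf' : MemLp (fun η => f (ξ - η)) p volume :=
    ⟨(hfm.comp (measurable_const.sub measurable_id)).aestronglyMeasurable,
      (eLpNorm_comp_sub_left hfm ξ).trans_lt hf.2⟩
  exact memLp_one_iff_integrable.1 (hg.mul hf')

theorem conv_sub_conv [ENNReal.HolderTriple p q 1] (hfm : Measurable f) (hfm' : Measurable f')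
    (hf : MemLp f p volume) (hf' : MemLp f' p volume)
    (hg : MemLp g q volume) (hg' : MemLp g' q volume) (ξ : ℝ × ℝ) :
    conv f g ξ - conv f' g' ξ = conv (f - f') g ξ + conv f' (g - g') ξ := by
  have h₁ := integrable_conv_integrand hfm hf hg ξ
  have h₂ := integrable_conv_integrand hfm' hf' hg ξ
  have h₃ := integrable_conv_integrand hfm' hf' hg' ξ
  simp only [conv, Pi.sub_apply, sub_mul, mul_sub]
  rw [integral_sub h₁ h₂, integral_sub h₂ h₃]
  ring

theorem measurable_dag (hf : Measurable f) : Measurable (dag f) :=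
  Complex.continuous_conj.measurable.comp (hf.comp measurable_neg)

theorem eLpNorm_dag (hf : Measurable f) : eLpNorm (dag f) p volume = eLpNorm f p volume := by
  rw [← eLpNorm_comp_measurePreserving hf.aestronglyMeasurable
    (Measure.measurePreserving_neg (volume : Measure (ℝ × ℝ)))]
  exact eLpNorm_congr_norm_ae (.of_forall fun x => by simp [dag])

theorem dag_sub : dag (f - g) = dag f - dag g := by
  funext x
  simp [dag]

theorem measurable_sigmaMul : Measurable sigmaMul :=
  Measurable.ite (measurableSet_singleton _) measurable_const (by fun_prop)

theorem enorm_sigmaMul_le (x : ℝ × ℝ) : ‖(sigmaMul x : ℂ)‖ₑ ≤ 1 := by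
  rw [← ofReal_norm, ← ENNReal.ofReal_one]
  refine ENNReal.ofReal_le_ofReal ?_
  rw [Complex.norm_real, sigmaMul]
  split_ifs
  · simp
  · rw [Real.norm_of_nonneg (by positivity)]
    exact div_le_one_of_le₀ (by nlinarith [sq_nonneg x.2]) (by positivity)

theorem enorm_sigmaMul_mul_le (z : ℂ) (x : ℝ × ℝ) : ‖(sigmaMul x : ℂ) * z‖ₑ ≤ ‖z‖ₑ := by
  rw [enorm_mul]
  exact (mul_le_mul_left (enorm_sigmaMul_le x) _).trans_eq (one_mul _)

/-- Controls the size of `d` as one factor of a cubic convolution whose other factors are bounded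
in `L¹ ∩ L²`. -/
def FactorBound (d : ℝ × ℝ → ℂ) (δ : ℝ≥0∞) : Prop :=
  (eLpNorm d 1 volume ≤ δ ∧ eLpNorm d 2 volume ≤ δ) ∨ eLpNorm d ∞ volume ≤ δ

variable {R δ : ℝ≥0∞}

theorem FactorBound.dag (hgm : Measurable g) (h : FactorBound g δ) : FactorBound (dag g) δ := by
  simpa only [FactorBound, eLpNorm_dag hgm] using h

theorem FactorBound.enorm_conv_left_le (hf : Measurable f) (hg : Measurable g)
    (h : FactorBound f δ) (h1 : eLpNorm g 1 volume ≤ R) (h2 : eLpNorm g 2 volume ≤ R)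
    (ξ : ℝ × ℝ) : ‖conv f g ξ‖ₑ ≤ δ * R := by
  rcases h with ⟨-, h⟩ | h
  · exact (enorm_conv_le (p := 2) (q := 2) hf hg ξ).trans (mul_le_mul' h h2)
  · exact (enorm_conv_le (p := ∞) (q := 1) hf hg ξ).trans (mul_le_mul' h h1)

theorem FactorBound.enorm_conv_right_le (hf : Measurable f) (hg : Measurable g)
    (h : FactorBound g δ) (h1 : eLpNorm f 1 volume ≤ R) (h2 : eLpNorm f 2 volume ≤ R)
    (ξ : ℝ × ℝ) : ‖conv f g ξ‖ₑ ≤ R * δ := by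
  rcases h with ⟨-, h⟩ | h
  · exact (enorm_conv_le (p := 2) (q := 2) hf hg ξ).trans (mul_le_mul' h2 h)
  · exact (enorm_conv_le (p := 1) (q := ∞) hf hg ξ).trans (mul_le_mul' h1 h)

theorem enorm_conv_dag_sub_le (hf : Measurable f) (hg : Measurable g) (hR : R < ∞)
    (hf1 : eLpNorm f 1 volume ≤ R) (hf2 : eLpNorm f 2 volume ≤ R)
    (hg1 : eLpNorm g 1 volume ≤ R) (hg2 : eLpNorm g 2 volume ≤ R)
    (hδ : FactorBound (f - g) δ) (ξ : ℝ × ℝ) :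
    ‖(conv f (dag f) - conv g (dag g)) ξ‖ₑ ≤ 2 * (R * δ) := by
  have hL : ∀ {u : ℝ × ℝ → ℂ}, Measurable u → eLpNorm u 2 volume ≤ R → MemLp u 2 volume :=
    fun hu h => ⟨hu.aestronglyMeasurable, h.trans_lt hR⟩
  rw [Pi.sub_apply, conv_sub_conv hf hg (hL hf hf2) (hL hg hg2)
    (hL (measurable_dag hf) (by rwa [eLpNorm_dag hf]))
    (hL (measurable_dag hg) (by rwa [eLpNorm_dag hg])), ← dag_sub, two_mul]
  refine (enorm_add_le _ _).trans (add_le_add ?_ ?_)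
  · rw [mul_comm R]
    exact hδ.enorm_conv_left_le (hf.sub hg) (measurable_dag hf) (by rwa [eLpNorm_dag hf])
      (by rwa [eLpNorm_dag hf]) ξ
  · exact (hδ.dag (hf.sub hg)).enorm_conv_right_le hg (measurable_dag (hf.sub hg)) hg1 hg2 ξ

theorem enorm_Lop_sub_le (γ lam μ : ℝ) (hf : Measurable f) (hg : Measurable g) (hR : R < ∞)
    (hf1 : eLpNorm f 1 volume ≤ R) (hf2 : eLpNorm f 2 volume ≤ R)
    (hg1 : eLpNorm g 1 volume ≤ R) (hg2 : eLpNorm g 2 volume ≤ R)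
    (hδ : FactorBound (f - g) δ) (ξ : ℝ × ℝ) :
    ‖Lop γ lam μ f ξ - Lop γ lam μ g ξ‖ₑ ≤
      (‖(γ : ℂ)‖ₑ + ‖((lam * μ : ℝ) : ℂ)‖ₑ) * (3 * R ^ 2) * δ := by
  have hP : ∀ {u : ℝ × ℝ → ℂ}, Measurable u → Measurable (conv u (dag u)) :=
    fun hu => measurable_conv hu (measurable_dag hu)
  have hσ : ∀ {u : ℝ × ℝ → ℂ}, Measurable u → Measurable fun η => (sigmaMul η : ℂ) * u η :=
    fun hu => (Complex.measurable_ofReal.comp measurable_sigmaMul).mul hu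
  have hσn : ∀ (u : ℝ × ℝ → ℂ) (p : ℝ≥0∞),
      eLpNorm (fun η => (sigmaMul η : ℂ) * u η) p volume ≤ eLpNorm u p volume :=
    fun u p => eLpNorm_mono_enorm fun η => enorm_sigmaMul_mul_le _ _
  have hP1 : ∀ {u : ℝ × ℝ → ℂ}, Measurable u → eLpNorm u 1 volume ≤ R →
      eLpNorm (conv u (dag u)) 1 volume ≤ R * R := fun hu h =>
    (eLpNorm_one_conv_le hu (measurable_dag hu)).trans
      (mul_le_mul' h (by rwa [eLpNorm_dag hu]))
  have hPt : ∀ {u : ℝ × ℝ → ℂ}, Measurable u → eLpNorm u 2 volume ≤ R →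
      eLpNorm (conv u (dag u)) ∞ volume ≤ R * R := fun hu h =>
    eLpNorm_top_le_of_forall fun x => (enorm_conv_le (p := 2) (q := 2) hu (measurable_dag hu) x).trans
      (mul_le_mul' h (by rwa [eLpNorm_dag hu]))
  have hRR : R * R < ∞ := ENNReal.mul_lt_top hR hR
  have hL : ∀ {u : ℝ × ℝ → ℂ}, Measurable u → eLpNorm u 1 volume ≤ R → MemLp u 1 volume :=
    fun hu h => ⟨hu.aestronglyMeasurable, h.trans_lt hR⟩
  have hLP : ∀ {u : ℝ × ℝ → ℂ}, Measurable u → eLpNorm u 2 volume ≤ R →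
      MemLp (conv u (dag u)) ∞ volume :=
    fun hu h => ⟨(hP hu).aestronglyMeasurable, (hPt hu h).trans_lt hRR⟩
  have hLσ : ∀ {u : ℝ × ℝ → ℂ}, Measurable u → eLpNorm u 2 volume ≤ R →
      MemLp (fun η => (sigmaMul η : ℂ) * conv u (dag u) η) ∞ volume :=
    fun hu h => ⟨(hσ (hP hu)).aestronglyMeasurable,
      (hσn _ _).trans_lt ((hPt hu h).trans_lt hRR)⟩
  have hdm := hf.sub hg
  have hD := enorm_conv_dag_sub_le hf hg hR hf1 hf2 hg1 hg2 hδ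
  have hDt := eLpNorm_top_le_of_forall hD
  have hDm : Measurable (conv f (dag f) - conv g (dag g)) := (hP hf).sub (hP hg)
  have hA : ‖conv (conv f (dag f)) f ξ - conv (conv g (dag g)) g ξ‖ₑ ≤ 3 * R ^ 2 * δ := by
    rw [conv_sub_conv (hP hf) (hP hg) (hLP hf hf2) (hLP hg hg2)
      (hL hf hf1) (hL hg hg1)]
    refine (enorm_add_le _ _).trans ?_
    have e1 : ‖conv (conv f (dag f) - conv g (dag g)) f ξ‖ₑ ≤ 2 * (R * δ) * R :=
      (enorm_conv_le (p := ∞) (q := 1) hDm hf ξ).trans (mul_le_mul' hDt hf1)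
    have e2 : ‖conv (conv g (dag g)) (f - g) ξ‖ₑ ≤ R * R * δ := by
      rcases hδ with ⟨h, -⟩ | h
      · exact (enorm_conv_le (p := ∞) (q := 1) (hP hg) hdm ξ).trans (mul_le_mul' (hPt hg hg2) h)
      · exact (enorm_conv_le (p := 1) (q := ∞) (hP hg) hdm ξ).trans (mul_le_mul' (hP1 hg hg1) h)
    exact (add_le_add e1 e2).trans_eq (by ring)
  have hB : ‖conv f (fun η => (sigmaMul η : ℂ) * conv f (dag f) η) ξ -
      conv g (fun η => (sigmaMul η : ℂ) * conv g (dag g) η) ξ‖ₑ ≤ 3 * R ^ 2 * δ := by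
    rw [conv_sub_conv hf hg (hL hf hf1) (hL hg hg1) (hLσ hf hf2) (hLσ hg hg2)]
    refine (enorm_add_le _ _).trans ?_
    have e1 : ‖conv (f - g) (fun η => (sigmaMul η : ℂ) * conv f (dag f) η) ξ‖ₑ ≤ δ * (R * R) := by
      rcases hδ with ⟨h, -⟩ | h
      · exact (enorm_conv_le (p := 1) (q := ∞) hdm (hσ (hP hf)) ξ).trans
          (mul_le_mul' h ((hσn _ _).trans (hPt hf hf2)))
      · exact (enorm_conv_le (p := ∞) (q := 1) hdm (hσ (hP hf)) ξ).trans
          (mul_le_mul' h ((hσn _ _).trans (hP1 hf hf1)))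
    have e2 : ‖conv g ((fun η => (sigmaMul η : ℂ) * conv f (dag f) η) -
        fun η => (sigmaMul η : ℂ) * conv g (dag g) η) ξ‖ₑ ≤ R * (2 * (R * δ)) := by
      refine (enorm_conv_le (p := 1) (q := ∞) hg ((hσ (hP hf)).sub (hσ (hP hg))) ξ).trans
        (mul_le_mul' hg1 (eLpNorm_top_le_of_forall fun x => ?_))
      rw [Pi.sub_apply, ← mul_sub]
      exact (enorm_sigmaMul_mul_le _ _).trans (hD x)
    exact (add_le_add e1 e2).trans_eq (by ring)
  calc ‖Lop γ lam μ f ξ - Lop γ lam μ g ξ‖ₑ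
      = ‖(γ : ℂ) * (conv (conv f (dag f)) f ξ - conv (conv g (dag g)) g ξ) +
        ((lam * μ : ℝ) : ℂ) * (conv f (fun η => (sigmaMul η : ℂ) * conv f (dag f) η) ξ -
          conv g (fun η => (sigmaMul η : ℂ) * conv g (dag g) η) ξ)‖ₑ := by
        congr 1
        simp only [Lop]
        ring
    _ ≤ ‖(γ : ℂ)‖ₑ * (3 * R ^ 2 * δ) + ‖((lam * μ : ℝ) : ℂ)‖ₑ * (3 * R ^ 2 * δ) := by
        refine (enorm_add_le _ _).trans (add_le_add ?_ ?_)
        · rw [enorm_mul]; gcongr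
        · rw [enorm_mul]; gcongr
    _ = _ := by ring

end Convolution

section WeightedNorm

variable {p T : ℝ} {f g : ℝ × ℝ → ℂ} {v w : ℝ → ℝ × ℝ → ℂ}

theorem measurable_weight (p : ℝ) : Measurable fun x : ℝ × ℝ => (1 + |x.1| + |x.2|) ^ p := by
  fun_prop

theorem wnorm_eq_eLpNorm (p : ℝ) (f : ℝ × ℝ → ℂ) :
    wnorm p f = eLpNorm (fun x : ℝ × ℝ => (1 + |x.1| + |x.2|) ^ p • f x) 2 volume := by
  rw [eLpNorm_eq_lintegral_rpow_enorm_toReal two_ne_zero ENNReal.ofNat_ne_top, wnorm]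
  simp only [ENNReal.toReal_ofNat]
  congr 1
  refine lintegral_congr fun x => ?_
  have hx : 0 ≤ 1 + |x.1| + |x.2| := by positivity
  rw [enorm_smul, ENNReal.mul_rpow_of_nonneg _ _ zero_le_two, ENNReal.rpow_two, ENNReal.rpow_two,
    Real.enorm_of_nonneg (by positivity), ← ENNReal.ofReal_pow (by positivity), mul_comm 2 p,
    Real.rpow_mul hx, Real.rpow_two]
  rfl

theorem wnorm_add_le (hf : Measurable f) (hg : Measurable g) :
    wnorm p (f + g) ≤ wnorm p f + wnorm p g := by
  simp only [wnorm_eq_eLpNorm]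
  have h := eLpNorm_add_le ((measurable_weight p).smul hf).aestronglyMeasurable
    ((measurable_weight p).smul hg).aestronglyMeasurable (μ := volume) (p := 2) one_le_two
  refine le_trans (le_of_eq ?_) h
  congr 1
  funext x
  exact smul_add _ _ _

theorem wnorm_congr_norm (h : ∀ x, ‖f x‖ = ‖g x‖) : wnorm p f = wnorm p g := by
  simp only [wnorm_eq_eLpNorm]
  exact eLpNorm_congr_norm_ae (.of_forall fun x => by simp only [norm_smul, h x])

theorem eLpNorm_two_le_wnorm (hp : 0 ≤ p) : eLpNorm f 2 volume ≤ wnorm p f := by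
  rw [wnorm_eq_eLpNorm]
  refine eLpNorm_mono fun x => ?_
  have h : 1 ≤ (1 + |x.1| + |x.2|) ^ p :=
    Real.one_le_rpow (by linarith [abs_nonneg x.1, abs_nonneg x.2]) hp
  rw [norm_smul, Real.norm_of_nonneg (by positivity)]
  exact le_mul_of_one_le_left (norm_nonneg _) h

theorem memLp_two_weight_neg (hp : 1 < p) :
    MemLp (fun x : ℝ × ℝ => (1 + |x.1| + |x.2|) ^ (-p)) 2 volume := by
  rw [memLp_two_iff_integrable_sq (measurable_weight (-p)).aestronglyMeasurable]
  have hi : Integrable (fun x : ℝ × ℝ => (1 + ‖x‖) ^ (-(2 * p))) :=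
    integrable_one_add_norm (by
      rw [Module.finrank_prod, Module.finrank_self]
      push_cast
      linarith)
  refine hi.mono' ((measurable_weight (-p)).pow_const 2).aestronglyMeasurable (.of_forall fun x => ?_)
  have hx : ‖x‖ ≤ |x.1| + |x.2| :=
    max_le (by simp) (by simp)
  rw [Real.norm_of_nonneg (by positivity), ← Real.rpow_two, ← Real.rpow_mul (by positivity),
    show -p * 2 = -(2 * p) by ring]
  exact Real.rpow_le_rpow_of_nonpos (by positivity) (by linarith) (by linarith)

theorem eLpNorm_one_le_wnorm (hf : Measurable f) :
    eLpNorm f 1 volume ≤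
      eLpNorm (fun x : ℝ × ℝ => (1 + |x.1| + |x.2|) ^ (-p)) 2 volume * wnorm p f := by
  rw [wnorm_eq_eLpNorm]
  refine le_trans (le_of_eq ?_) (eLpNorm_smul_le_mul_eLpNorm (p := 2) (q := 2) (r := 1)
    ((measurable_weight p).smul hf).aestronglyMeasurable
    (measurable_weight (-p)).aestronglyMeasurable)
  congr 1
  funext x
  have hx : 0 < 1 + |x.1| + |x.2| := by positivity
  simp only [Pi.smul_apply', smul_smul]
  rw [← Real.rpow_add hx, neg_add_cancel, Real.rpow_zero, one_smul]

theorem exists_eLpNorm_le_wnorm (hp : 1 < p) : ∃ K : ℝ≥0∞, K < ∞ ∧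
    ∀ f : ℝ × ℝ → ℂ, Measurable f →
      eLpNorm f 1 volume ≤ K * wnorm p f ∧ eLpNorm f 2 volume ≤ K * wnorm p f := by
  refine ⟨max 1 (eLpNorm (fun x : ℝ × ℝ => (1 + |x.1| + |x.2|) ^ (-p)) 2 volume),
    max_lt ENNReal.one_lt_top (memLp_two_weight_neg hp).2, fun f hf => ⟨?_, ?_⟩⟩
  · exact (eLpNorm_one_le_wnorm hf).trans (mul_le_mul_left (le_max_right _ _) _)
  · refine (eLpNorm_two_le_wnorm (zero_le_one.trans hp.le)).trans ?_
    calc wnorm p f = 1 * wnorm p f := (one_mul _).symm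
      _ ≤ _ := mul_le_mul_left (le_max_left _ _) _

theorem measurable_phase2 (t : ℝ) : Measurable (phase2 t) := by
  unfold phase2
  fun_prop

theorem norm_phase2 (t : ℝ) (x : ℝ × ℝ) : ‖phase2 t x‖ = 1 := by
  rw [phase2, show 2 * Complex.I * (((x.1 ^ 2 - x.2 ^ 2) * t : ℝ) : ℂ) =
    ((2 * ((x.1 ^ 2 - x.2 ^ 2) * t) : ℝ) : ℂ) * Complex.I by push_cast; ring]
  exact Complex.norm_exp_ofReal_mul_I _

theorem continuous_phase2 (x : ℝ × ℝ) : Continuous fun t => phase2 t x := by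
  unfold phase2
  fun_prop

theorem tendsto_wnorm_mul_phase2_sub (hf : Measurable f) (hfin : wnorm p f < ∞) (t₀ : ℝ) :
    Tendsto (fun t => wnorm p fun x => f x * phase2 t x - f x * phase2 t₀ x) (𝓝 t₀) (𝓝 0) := by
  have hfin' : ∫⁻ x : ℝ × ℝ, ENNReal.ofReal ((1 + |x.1| + |x.2|) ^ (2 * p)) *
      (‖f x‖₊ : ℝ≥0∞) ^ 2 ≠ ∞ := by
    intro h
    rw [wnorm, h, ENNReal.top_rpow_of_pos (by norm_num)] at hfin
    exact lt_irrefl _ hfin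
  have hcont : Continuous fun y : ℝ≥0∞ => y ^ ((1 : ℝ) / 2) := ENNReal.continuous_rpow_const
  have key : Tendsto (fun t => ∫⁻ x : ℝ × ℝ, ENNReal.ofReal ((1 + |x.1| + |x.2|) ^ (2 * p)) *
      (‖f x * phase2 t x - f x * phase2 t₀ x‖₊ : ℝ≥0∞) ^ 2) (𝓝 t₀)
      (𝓝 (∫⁻ _ : ℝ × ℝ, 0)) := by
    refine tendsto_lintegral_filter_of_dominated_convergence
      (fun x => 4 * (ENNReal.ofReal ((1 + |x.1| + |x.2|) ^ (2 * p)) * (‖f x‖₊ : ℝ≥0∞) ^ 2))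
      (.of_forall fun t => ?_) (.of_forall fun t => .of_forall fun x => ?_) ?_
      (.of_forall fun x => ?_)
    · exact (measurable_weight _).ennreal_ofReal.mul
        ((((hf.mul (measurable_phase2 t)).sub
          (hf.mul (measurable_phase2 t₀))).nnnorm.coe_nnreal_ennreal).pow_const 2)
    · have h : ‖f x * phase2 t x - f x * phase2 t₀ x‖₊ ≤ 2 * ‖f x‖₊ := by
        rw [← NNReal.coe_le_coe]
        push_cast
        refine (norm_sub_le _ _).trans_eq ?_
        rw [norm_mul, norm_mul, norm_phase2, norm_phase2]
        ring
      have h' : (‖f x * phase2 t x - f x * phase2 t₀ x‖₊ : ℝ≥0∞) ≤ 2 * ‖f x‖₊ := by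
        exact_mod_cast h
      calc _ ≤ ENNReal.ofReal ((1 + |x.1| + |x.2|) ^ (2 * p)) * (2 * (‖f x‖₊ : ℝ≥0∞)) ^ 2 := by
            gcongr
        _ = _ := by ring
    · rw [lintegral_const_mul' _ _ (by norm_num)]
      exact ENNReal.mul_ne_top (by norm_num) hfin'
    · have h1 : Tendsto (fun t => f x * phase2 t x - f x * phase2 t₀ x) (𝓝 t₀) (𝓝 0) := by
        have := (((continuous_phase2 x).const_mul (f x)).sub
          (continuous_const (y := f x * phase2 t₀ x))).tendsto t₀
        simpa [Pi.sub_def] using this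
      have h2 := ((ENNReal.continuous_pow 2).tendsto _).comp h1.enorm
      have h3 := ENNReal.Tendsto.const_mul h2
        (Or.inr (ENNReal.ofReal_ne_top (r := (1 + |x.1| + |x.2|) ^ (2 * p))))
      simpa [enorm_eq_nnnorm, Function.comp_def] using h3
  have := (hcont.tendsto _).comp key
  simpa [wnorm, Function.comp_def] using this

/-- The curve `t ↦ v(t) · e_{2t}`. -/
noncomputable def modulate (v : ℝ → ℝ × ℝ → ℂ) (t : ℝ) : ℝ × ℝ → ℂ :=
  fun x => v t x * phase2 t x

theorem measurable_modulate {t : ℝ} (hv : Measurable (v t)) : Measurable (modulate v t) :=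
  hv.mul (measurable_phase2 t)

theorem wnorm_modulate (t : ℝ) : wnorm p (modulate v t) = wnorm p (v t) :=
  wnorm_congr_norm fun x => by rw [modulate, norm_mul, norm_phase2, mul_one]

theorem ContCurve.tendsto_wnorm_modulate_sub (hv : ContCurve p T v)
    (hvfin : ∀ t ∈ Set.Icc (0 : ℝ) T, wnorm p (v t) < ∞) {t₀ : ℝ} (ht₀ : t₀ ∈ Set.Icc 0 T) :
    Tendsto (fun t => wnorm p (modulate v t - modulate v t₀)) (𝓝[Set.Icc 0 T] t₀) (𝓝 0) := by
  have h := (hv.2 t₀ ht₀).add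
    ((tendsto_wnorm_mul_phase2_sub (hv.1 t₀ ht₀) (hvfin t₀ ht₀) t₀).mono_left nhdsWithin_le_nhds)
  rw [add_zero] at h
  refine tendsto_of_tendsto_of_tendsto_of_le_of_le' tendsto_const_nhds h
    (.of_forall fun _ => zero_le) ?_
  filter_upwards [self_mem_nhdsWithin] with t ht
  have hm := hv.1 t ht
  have hm₀ := hv.1 t₀ ht₀
  have hsplit : modulate v t - modulate v t₀ = (fun x => (v t - v t₀) x * phase2 t x) +
      fun x => v t₀ x * phase2 t x - v t₀ x * phase2 t₀ x := by
    funext x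
    simp only [modulate, Pi.sub_apply, Pi.add_apply]
    ring
  rw [hsplit]
  refine (wnorm_add_le ((hm.sub hm₀).mul (measurable_phase2 t))
    ((hm₀.mul (measurable_phase2 t)).sub (hm₀.mul (measurable_phase2 t₀)))).trans_eq ?_
  congr 1
  exact wnorm_congr_norm fun x => by rw [Pi.mul_apply, norm_mul, norm_phase2, mul_one]

theorem ContCurve.exists_wnorm_le (hv : ContCurve p T v)
    (hvfin : ∀ t ∈ Set.Icc (0 : ℝ) T, wnorm p (v t) < ∞) :
    ∃ R : ℝ≥0∞, R < ∞ ∧ ∀ t ∈ Set.Icc (0 : ℝ) T, wnorm p (v t) ≤ R := by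
  refine (isCompact_Icc (a := (0 : ℝ)) (b := T)).induction_on
    (p := fun s => ∃ R : ℝ≥0∞, R < ∞ ∧ ∀ t ∈ s, wnorm p (v t) ≤ R)
    ⟨0, ENNReal.zero_lt_top, by simp⟩ ?_ ?_ ?_
  · rintro s t hst ⟨R, hR, h⟩
    exact ⟨R, hR, fun x hx => h x (hst hx)⟩
  · rintro s t ⟨R, hR, h⟩ ⟨R', hR', h'⟩
    refine ⟨max R R', max_lt hR hR', ?_⟩
    rintro x (hx | hx)
    · exact (h x hx).trans (le_max_left _ _)
    · exact (h' x hx).trans (le_max_right _ _)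
  · intro t₀ ht₀
    refine ⟨_, inter_mem self_mem_nhdsWithin
      ((hv.2 t₀ ht₀).eventually_lt_const zero_lt_one), 1 + wnorm p (v t₀),
      ENNReal.add_lt_top.2 ⟨ENNReal.one_lt_top, hvfin t₀ ht₀⟩, ?_⟩
    rintro t ⟨ht, h1 : wnorm p (v t - v t₀) < 1⟩
    calc wnorm p (v t) = wnorm p ((v t - v t₀) + v t₀) := by rw [sub_add_cancel]
      _ ≤ wnorm p (v t - v t₀) + wnorm p (v t₀) :=
        wnorm_add_le ((hv.1 t ht).sub (hv.1 t₀ ht₀)) (hv.1 t₀ ht₀)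
      _ ≤ _ := by gcongr

theorem ContCurve.exists_eLpNorm_modulate_le (hp : 1 < p) (hv : ContCurve p T v)
    (hvfin : ∀ t ∈ Set.Icc (0 : ℝ) T, wnorm p (v t) < ∞) :
    ∃ R : ℝ≥0∞, R < ∞ ∧ ∀ t ∈ Set.Icc (0 : ℝ) T,
      eLpNorm (modulate v t) 1 volume ≤ R ∧ eLpNorm (modulate v t) 2 volume ≤ R := by
  obtain ⟨K, hK, hKle⟩ := exists_eLpNorm_le_wnorm hp
  obtain ⟨R, hR, hRle⟩ := hv.exists_wnorm_le hvfin
  refine ⟨K * R, ENNReal.mul_lt_top hK hR, fun t ht => ?_⟩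
  have h := hKle _ (measurable_modulate (hv.1 t ht))
  have h' : K * wnorm p (modulate v t) ≤ K * R := by
    rw [wnorm_modulate]
    exact mul_le_mul_right (hRle t ht) K
  exact ⟨h.1.trans h', h.2.trans h'⟩

theorem ContCurve.continuousOn_Lop (hp : 1 < p) (hv : ContCurve p T v)
    (hvfin : ∀ t ∈ Set.Icc (0 : ℝ) T, wnorm p (v t) < ∞) (γ lam μ : ℝ) (ξ : ℝ × ℝ) :
    ContinuousOn (fun t => Lop γ lam μ (modulate v t) ξ) (Set.Icc 0 T) := by
  obtain ⟨K, hK, hKle⟩ := exists_eLpNorm_le_wnorm hp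
  obtain ⟨R, hR, hRle⟩ := hv.exists_eLpNorm_modulate_le hp hvfin
  intro t₀ ht₀
  set C : ℝ≥0∞ := (‖(γ : ℂ)‖ₑ + ‖((lam * μ : ℝ) : ℂ)‖ₑ) * (3 * R ^ 2) * K with hC
  have hCtop : C ≠ ∞ := ENNReal.mul_ne_top (ENNReal.mul_ne_top
    (ENNReal.add_ne_top.2 ⟨enorm_ne_top, enorm_ne_top⟩)
    (ENNReal.mul_ne_top (by norm_num) (ENNReal.pow_ne_top hR.ne))) hK.ne
  have h := ENNReal.Tendsto.const_mul (hv.tendsto_wnorm_modulate_sub hvfin ht₀) (Or.inr hCtop)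
  rw [mul_zero] at h
  refine tendsto_iff_edist_tendsto_0.2 (tendsto_of_tendsto_of_tendsto_of_le_of_le'
    tendsto_const_nhds h (.of_forall fun _ => zero_le) ?_)
  filter_upwards [self_mem_nhdsWithin] with t ht
  have hm := measurable_modulate (hv.1 t ht)
  have hm₀ := measurable_modulate (hv.1 t₀ ht₀)
  rw [edist_eq_enorm_sub, hC, mul_assoc _ K]
  exact enorm_Lop_sub_le γ lam μ hm hm₀ hR (hRle t ht).1 (hRle t ht).2 (hRle t₀ ht₀).1
    (hRle t₀ ht₀).2 (Or.inl (hKle _ (hm.sub hm₀))) ξ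

end WeightedNorm

section Uniqueness

variable {p T γ lam μ : ℝ} {u0 : ℝ × ℝ → ℂ} {v w : ℝ → ℝ × ℝ → ℂ}

theorem norm_duhamel_sub_le {ξ : ℝ × ℝ} {b : ℝ → ℝ} {t : ℝ}
    (hv : ContinuousOn (fun τ => Lop γ lam μ (modulate v τ) ξ) (Set.Icc 0 T))
    (hw : ContinuousOn (fun τ => Lop γ lam μ (modulate w τ) ξ) (Set.Icc 0 T))
    (hb : Continuous b)
    (hle : ∀ τ ∈ Set.Icc (0 : ℝ) T,
      ‖Lop γ lam μ (modulate v τ) ξ - Lop γ lam μ (modulate w τ) ξ‖ ≤ b τ)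
    (ht : t ∈ Set.Icc (0 : ℝ) T) :
    ‖duhamel γ lam μ u0 v t ξ - duhamel γ lam μ u0 w t ξ‖ ≤ ∫ τ in (0 : ℝ)..t, b τ := by
  set E : ℝ → ℂ := fun τ => Complex.exp (Complex.I * (((ξ.1 ^ 2 - ξ.2 ^ 2) * (τ - t) : ℝ) : ℂ))
    with hE
  have hEc : Continuous E := by fun_prop
  have hEn : ∀ τ, ‖E τ‖ = 1 := fun τ => by
    simp only [hE]
    rw [mul_comm Complex.I]
    exact Complex.norm_exp_ofReal_mul_I _
  have hsub : Set.uIcc 0 t ⊆ Set.Icc 0 T := by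
    rw [Set.uIcc_of_le ht.1]
    exact Set.Icc_subset_Icc_right ht.2
  have hint : ∀ {u : ℝ → ℝ × ℝ → ℂ},
      ContinuousOn (fun τ => Lop γ lam μ (modulate u τ) ξ) (Set.Icc 0 T) →
      IntervalIntegrable (fun τ => E τ * Lop γ lam μ (modulate u τ) ξ) volume 0 t := fun hu =>
    (hEc.continuousOn.mul (hu.mono hsub)).intervalIntegrable
  have heq : duhamel γ lam μ u0 v t ξ - duhamel γ lam μ u0 w t ξ =
      -Complex.I * ∫ τ in (0 : ℝ)..t,
        E τ * (Lop γ lam μ (modulate v τ) ξ - Lop γ lam μ (modulate w τ) ξ) := by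
    simp only [mul_sub]
    rw [intervalIntegral.integral_sub (hint hv) (hint hw), duhamel, duhamel]
    change _ - Complex.I * (∫ τ in (0 : ℝ)..t, E τ * Lop γ lam μ (modulate v τ) ξ) -
      (_ - Complex.I * ∫ τ in (0 : ℝ)..t, E τ * Lop γ lam μ (modulate w τ) ξ) = _
    ring
  rw [heq, norm_mul, norm_neg, Complex.norm_I, one_mul]
  refine intervalIntegral.norm_integral_le_of_norm_le ht.1 (.of_forall fun τ hτ => ?_)
    (hb.intervalIntegrable _ _)
  rw [norm_mul, hEn, one_mul]
  exact hle τ ⟨hτ.1.le, hτ.2.trans ht.2⟩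

theorem eLpNorm_top_modulate_sub_le {t B : ℝ} (h : ∀ᵐ ξ : ℝ × ℝ, ‖v t ξ - w t ξ‖ ≤ B) :
    eLpNorm (modulate v t - modulate w t) ∞ volume ≤ ENNReal.ofReal B := by
  rw [eLpNorm_exponent_top]
  refine eLpNormEssSup_le_of_ae_bound ?_
  filter_upwards [h] with ξ hξ
  rwa [Pi.sub_apply, modulate, modulate, ← sub_mul, norm_mul, norm_phase2, mul_one]

theorem integral_const_mul_pow_div_factorial (M c t : ℝ) (n : ℕ) :
    ∫ τ in (0 : ℝ)..t, M * ((c * τ) ^ n / n.factorial) =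
      M * c ^ n * t ^ (n + 1) / (n + 1).factorial := by
  have h : ∀ τ : ℝ, M * ((c * τ) ^ n / n.factorial) = M * c ^ n / n.factorial * τ ^ n :=
    fun τ => by ring
  simp only [h]
  rw [intervalIntegral.integral_const_mul, integral_pow, Nat.factorial_succ]
  push_cast
  field_simp
  simp

theorem exists_norm_sub_le_of_duhamel (hp : 1 < p) (hv : ContCurve p T v) (hw : ContCurve p T w)
    (hvfin : ∀ t ∈ Set.Icc (0 : ℝ) T, wnorm p (v t) < ∞)
    (hwfin : ∀ t ∈ Set.Icc (0 : ℝ) T, wnorm p (w t) < ∞)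
    (hveq : ∀ t ∈ Set.Icc (0 : ℝ) T, ∀ᵐ ξ : ℝ × ℝ, v t ξ = duhamel γ lam μ u0 v t ξ)
    (hweq : ∀ t ∈ Set.Icc (0 : ℝ) T, ∀ᵐ ξ : ℝ × ℝ, w t ξ = duhamel γ lam μ u0 w t ξ) :
    ∃ M c : ℝ, ∀ n : ℕ, ∀ t ∈ Set.Icc (0 : ℝ) T, ∀ᵐ ξ : ℝ × ℝ,
      ‖v t ξ - w t ξ‖ ≤ M * c ^ n * t ^ (n + 1) / (n + 1).factorial := by
  obtain ⟨Rv, hRv, hvle⟩ := hv.exists_eLpNorm_modulate_le hp hvfin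
  obtain ⟨Rw, hRw, hwle⟩ := hw.exists_eLpNorm_modulate_le hp hwfin
  set R := max Rv Rw
  have hR : R < ∞ := max_lt hRv hRw
  have hv1 := fun t ht => (hvle t ht).1.trans (le_max_left Rv Rw)
  have hv2 := fun t ht => (hvle t ht).2.trans (le_max_left Rv Rw)
  have hw1 := fun t ht => (hwle t ht).1.trans (le_max_right Rv Rw)
  have hw2 := fun t ht => (hwle t ht).2.trans (le_max_right Rv Rw)
  set C : ℝ≥0∞ := (‖(γ : ℂ)‖ₑ + ‖((lam * μ : ℝ) : ℂ)‖ₑ) * (3 * R ^ 2)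
  have hC : C ≠ ∞ := ENNReal.mul_ne_top (ENNReal.add_ne_top.2 ⟨enorm_ne_top, enorm_ne_top⟩)
    (ENNReal.mul_ne_top (by norm_num) (ENNReal.pow_ne_top hR.ne))
  have hLop : ∀ t ∈ Set.Icc (0 : ℝ) T, ∀ δ : ℝ≥0∞, δ < ∞ →
      FactorBound (modulate v t - modulate w t) δ → ∀ ξ,
      ‖Lop γ lam μ (modulate v t) ξ - Lop γ lam μ (modulate w t) ξ‖ ≤
        C.toReal * δ.toReal := by
    intro t ht δ hδ hb ξ
    rw [← ENNReal.toReal_mul, ← toReal_enorm]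
    exact ENNReal.toReal_mono (ENNReal.mul_ne_top hC hδ.ne)
      (enorm_Lop_sub_le γ lam μ (measurable_modulate (hv.1 t ht)) (measurable_modulate (hw.1 t ht))
        hR (hv1 t ht) (hv2 t ht) (hw1 t ht) (hw2 t ht) hb ξ)
  set M : ℝ := C.toReal * (R + R).toReal
  have hstep : ∀ n : ℕ, (∀ t ∈ Set.Icc (0 : ℝ) T, ∀ ξ,
      ‖Lop γ lam μ (modulate v t) ξ - Lop γ lam μ (modulate w t) ξ‖ ≤
        M * ((C.toReal * t) ^ n / n.factorial)) → ∀ t ∈ Set.Icc (0 : ℝ) T, ∀ᵐ ξ : ℝ × ℝ,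
      ‖v t ξ - w t ξ‖ ≤ M * C.toReal ^ n * t ^ (n + 1) / (n + 1).factorial := by
    intro n hn t ht
    filter_upwards [hveq t ht, hweq t ht] with ξ h1 h2
    rw [h1, h2, ← integral_const_mul_pow_div_factorial]
    exact norm_duhamel_sub_le (hv.continuousOn_Lop hp hvfin γ lam μ ξ)
      (hw.continuousOn_Lop hp hwfin γ lam μ ξ) (by fun_prop) (fun τ hτ => hn τ hτ ξ) ht
  refine ⟨M, C.toReal, fun n => hstep n ?_⟩
  induction n with
  | zero =>
    intro t ht ξ
    have hmv := (measurable_modulate (hv.1 t ht)).aestronglyMeasurable (μ := volume)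
    have hmw := (measurable_modulate (hw.1 t ht)).aestronglyMeasurable (μ := volume)
    have hb : FactorBound (modulate v t - modulate w t) (R + R) :=
      Or.inl ⟨(eLpNorm_sub_le hmv hmw le_rfl).trans (add_le_add (hv1 t ht) (hw1 t ht)),
        (eLpNorm_sub_le hmv hmw one_le_two).trans (add_le_add (hv2 t ht) (hw2 t ht))⟩
    simpa using hLop t ht _ (ENNReal.add_lt_top.2 ⟨hR, hR⟩) hb ξ
  | succ n ih =>
    intro t ht ξ
    have hB : 0 ≤ M * C.toReal ^ n * t ^ (n + 1) / (n + 1).factorial := by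
      have := ht.1
      positivity
    refine (hLop t ht _ ENNReal.ofReal_lt_top
      (Or.inr (eLpNorm_top_modulate_sub_le (hstep n ih t ht))) ξ).trans_eq ?_
    rw [ENNReal.toReal_ofReal hB]
    ring

end Uniqueness

/-- **Uniqueness of mild solutions of the Fourier-transformed Davey–Stewartson-II
system.** For `p > 1`, `T > 0` and measurable `û₀` with `‖û₀‖_p < ∞`, any two continuous
curves `v, w : [0,T] → X_p` satisfying the Duhamel integral equation coincide in `X_p`
for every `t ∈ [0,T]`. -/
theorem ds_mild_uniqueness (p : ℝ) (hp : 1 < p) (γ lam μ : ℝ) (T : ℝ) (hT : 0 < T)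
    (u0 : ℝ × ℝ → ℂ) (hu0 : Measurable u0) (hfin : wnorm p u0 < ⊤)
    (v w : ℝ → ℝ × ℝ → ℂ)
    (hv : ContCurve p T v) (hw : ContCurve p T w)
    (hvfin : ∀ t ∈ Set.Icc (0 : ℝ) T, wnorm p (v t) < ⊤)
    (hwfin : ∀ t ∈ Set.Icc (0 : ℝ) T, wnorm p (w t) < ⊤)
    (hveq : ∀ t ∈ Set.Icc (0 : ℝ) T, ∀ᵐ km : ℝ × ℝ, v t km = duhamel γ lam μ u0 v t km)
    (hweq : ∀ t ∈ Set.Icc (0 : ℝ) T, ∀ᵐ km : ℝ × ℝ, w t km = duhamel γ lam μ u0 w t km) :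
    ∀ t ∈ Set.Icc (0 : ℝ) T, ∀ᵐ km : ℝ × ℝ, v t km = w t km := by
  intro t ht
  obtain ⟨M, c, h⟩ := exists_norm_sub_le_of_duhamel hp hv hw hvfin hwfin hveq hweq
  filter_upwards [ae_all_iff.2 fun n => h n t ht] with ξ hξ
  refine sub_eq_zero.1 (norm_le_zero_iff.1 ?_)
  by_cases hc : c = 0
  · simpa [hc] using hξ 1
  have hlim : Tendsto (fun n : ℕ => M * c ^ n * t ^ (n + 1) / (n + 1).factorial) atTop (𝓝 0) := by
    have := ((FloorSemiring.tendsto_pow_div_factorial_atTop (c * t)).comp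
      (tendsto_add_atTop_nat 1)).const_mul (M / c)
    rw [mul_zero] at this
    refine this.congr fun n => ?_
    simp only [Function.comp_apply]
    field_simp
    ring
  exact ge_of_tendsto' hlim hξ
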